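/- Let X_n = O((ξ_n,q_n)) be a sequence of T-periodic orbits with repetitive pattern, where ξ_n is generated by a finite word of length π_n. Then the sequence of projected measures ν_n := (1/π_n) Σ_{ℓ=0}^{π_n−1} δ_{σ^ℓ(ξ_n)} converges in the weak-star topology to a σ-invariant ergodic probability measure ν on Σ_k whose measure-theoretic (Kolmogorov–Sinai) entropy satisfies h_ν(σ) = 0. -/

import Mathlib

open MeasureTheory Filter Set
open scoped ENNReal NNReal

noncomputable section

/-- The two-sided full shift space on `k` symbols. -/
abbrev Shift (k : ℕ) := ℤ → Fin k

/-- The shift map `σ`. -/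
def shiftMap (k : ℕ) : Shift k → Shift k := fun ξ i => ξ (i + 1)

/-- The circle `S¹`, modelled as `ℝ/ℤ`. -/
abbrev Circle1 := AddCircle (1 : ℝ)

/-- The phase space `M = Σ_k × S¹`. -/
abbrev SkewM (k : ℕ) := Shift k × Circle1

/-- Canonical projection `ℝ → S¹`. -/
def projCircle : ℝ → Circle1 := fun x => (x : Circle1)

/-- A locally constant skew product system over the full shift with circle fibers:
the fiber maps `f j` are `C¹` diffeomorphisms of the circle, recorded together with
lifts `F j : ℝ → ℝ`. -/
structure SkewSetup (k : ℕ) where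
  f : Fin k → Circle1 → Circle1
  F : Fin k → ℝ → ℝ
  compat : ∀ j (x : ℝ), f j (projCircle x) = projCircle (F j x)
  F_equiv : ∀ j x, F j (x + 1) = F j x + 1
  F_smooth : ∀ j, ContDiff ℝ 1 (F j)
  F_bij : ∀ j, Function.Bijective (F j)
  Finv_smooth : ∀ j, ContDiff ℝ 1 (Function.invFun (F j))

/-- The skew product map `T(ξ,x) = (σξ, f_{ξ₀} x)`. -/
def SkewSetup.T {k : ℕ} (S : SkewSetup k) : SkewM k → SkewM k :=
  fun z => (shiftMap k z.1, S.f (z.1 0) z.2)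

/-- The composition `f_{w (m-1)} ∘ ⋯ ∘ f_{w 0}` of the fiber maps along a word `w`. -/
def SkewSetup.wordComp {k : ℕ} (S : SkewSetup k) (w : ℕ → Fin k) : ℕ → Circle1 → Circle1
  | 0 => id
  | m + 1 => S.f (w m) ∘ S.wordComp w m

/-- The corresponding composition of the lifts. -/
def SkewSetup.wordCompLift {k : ℕ} (S : SkewSetup k) (w : ℕ → Fin k) : ℕ → ℝ → ℝ
  | 0 => id
  | m + 1 => S.F (w m) ∘ S.wordCompLift w m

/-- A sequence of `T`-periodic orbits with repetitive pattern (Definition 2.2 of the paper).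
The `n`-th periodic point is `(ξ n, q n)` where `ξ n` is the infinite repetition of the
word `w n 0, …, w n (π n - 1)`; the intervals `J n ⊆ S¹` are the arcs
`projCircle '' Icc (a n) (b n)`. -/
structure RepetitivePattern {k : ℕ} (S : SkewSetup k) where
  /-- the periods -/
  π : ℕ → ℕ
  π_pos : ∀ n, 0 < π n
  /-- the words (`w n i` is the letter `ω^n_{i+1}` of the paper) -/
  w : ℕ → ℕ → Fin k
  /-- the fiber coordinates of the periodic points -/
  q : ℕ → Circle1
  /-- endpoints of (lifts of) the intervals `J n` -/
  a : ℕ → ℝ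
  b : ℕ → ℝ
  a_lt_b : ∀ n, a n < b n
  nested : ∀ n, Icc (a (n + 1)) (b (n + 1)) ⊆ Icc (a n) (b n)
  len_lt : ∀ n, b (n + 1) - a (n + 1) < b n - a n
  len_to_zero : Tendsto (fun n => b n - a n) atTop (nhds 0)
  q_mem : ∀ n, q n ∈ projCircle '' Icc (a n) (b n)
  /-- `J 0, f_{ω^0_1}(J 0), …, f_{ω^0_{π 0 - 1}}∘⋯∘f_{ω^0_1}(J 0)` are pairwise disjoint -/
  disjoint0 : ∀ ℓ₁ ℓ₂, ℓ₁ < ℓ₂ → ℓ₂ < π 0 →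
    Disjoint (S.wordComp (w 0) ℓ₁ '' (projCircle '' Icc (a 0) (b 0)))
             (S.wordComp (w 0) ℓ₂ '' (projCircle '' Icc (a 0) (b 0)))
  /-- `q n` is fixed by `g n = f_{ω^n_{π n}} ∘ ⋯ ∘ f_{ω^n_1}` -/
  fixed : ∀ n, S.wordComp (w n) (π n) (q n) = q n
  /-- `|g_n'| < 1` on `J n` -/
  contracting : ∀ n, ∀ x ∈ Icc (a n) (b n), |deriv (S.wordCompLift (w n) (π n)) x| < 1
  /-- the numbers `k_n` (for `n ≥ 1`) -/
  kseq : ℕ → ℕ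
  /-- the numbers `R_n` (for `n ≥ 1`) -/
  Rseq : ℕ → ℕ
  kseq_ge : ∀ n, 2 ≤ kseq (n + 1)
  Rseq_ge : ∀ n, 1 ≤ Rseq (n + 1)
  /-- `g (n+1) = T_{R (n+1)} ∘ (g n)^{k (n+1)}`, encoded on the level of words:
  the word of `ξ (n+1)` is `k (n+1)` repetitions of the word of `ξ n` followed by a
  word of length `R (n+1)` -/
  period_eq : ∀ n, π (n + 1) = kseq (n + 1) * π n + Rseq (n + 1)
  word_eq : ∀ n, ∀ i < kseq (n + 1) * π n, w (n + 1) i = w n (i % π n)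
  /-- the sequence `λ_n = R_n / (k_n π_{n-1})` is summable -/
  lam_summable : Summable fun n => (Rseq (n + 1) : ℝ) / (kseq (n + 1) * π n)

namespace RepetitivePattern

variable {k : ℕ} {S : SkewSetup k}

/-- The `σ`-periodic point `ξ n`, the infinite repetition of the `n`-th word. -/
def ξp (P : RepetitivePattern S) (n : ℕ) : Shift k :=
  fun i => P.w n (Int.toNat (i % (P.π n : ℤ)))

/-- The measure `μ_{X_n}`, uniformly distributed on the `n`-th periodic orbit. -/
def μX (P : RepetitivePattern S) (n : ℕ) : Measure (SkewM k) :=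
  (P.π n : ℝ≥0∞)⁻¹ • ∑ ℓ ∈ Finset.range (P.π n), Measure.dirac (S.T^[ℓ] (P.ξp n, P.q n))

/-- The projected measure `ν_n`, uniformly distributed on the `σ`-orbit of `ξ n`. -/
def νX (P : RepetitivePattern S) (n : ℕ) : Measure (Shift k) :=
  (P.π n : ℝ≥0∞)⁻¹ • ∑ ℓ ∈ Finset.range (P.π n), Measure.dirac ((shiftMap k)^[ℓ] (P.ξp n))

end RepetitivePattern

/-- Weak-star convergence of a sequence of measures. -/
def WeakStarTendsto {X : Type*} [TopologicalSpace X] [MeasurableSpace X]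
    (μs : ℕ → Measure X) (μ : Measure X) : Prop :=
  ∀ g : C(X, ℝ), Tendsto (fun n => ∫ x, g x ∂(μs n)) atTop (nhds (∫ x, g x ∂μ))

/-- A probability measure on `M` has periodic repetitive pattern if it is the weak-star
limit of the measures `μ_{X_n}` for some sequence of periodic orbits with repetitive
pattern. -/
def HasPeriodicRepetitivePattern {k : ℕ} (S : SkewSetup k) (μ : Measure (SkewM k)) : Prop :=
  ∃ P : RepetitivePattern S, WeakStarTendsto (fun n => P.μX n) μ

/-- The Kolmogorov–Sinai (measure-theoretic) entropy of `T` with respect to `μ`: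
the supremum, over all finite measurable colorings `c : X → Fin m`, of the entropy of the
associated process, the latter being computed (via subadditivity) as the infimum of
`H_n/n` where `H_n` is the Shannon entropy of the partition of `X` according to the
itinerary `(c x, c (T x), …, c (T^{n-1} x))`. -/
def ksEntropy {X : Type*} [MeasurableSpace X] (T : X → X) (μ : Measure X) : ℝ≥0∞ :=
  ⨆ (m : ℕ) (c : {c : X → Fin m // Measurable c}),
    ⨅ n : ℕ, ENNReal.ofReal
      ((∑ s : Fin (n + 1) → Fin m,
        Real.negMulLog ((μ {x | ∀ i : Fin (n + 1), c.1 (T^[(i : ℕ)] x) = s i}).toReal))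
        / ((n : ℝ) + 1))


lemma shiftMap_iterate_apply {k : ℕ} (ℓ : ℕ) (x : Shift k) (i : ℤ) :
    (shiftMap k)^[ℓ] x i = x (i + ℓ) := by
  induction ℓ generalizing x with
  | zero => simp
  | succ ℓ ih =>
    rw [Function.iterate_succ_apply, ih]
    simp only [shiftMap]
    push_cast
    ring_nf

lemma continuous_shiftMap (k : ℕ) : Continuous (shiftMap k) :=
  continuous_pi fun i => continuous_apply (i + 1)

lemma sum_range_mul_of_periodic {a : ℕ → ℝ} {p : ℕ} (ha : Function.Periodic a p) (m : ℕ) :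
    ∑ ℓ ∈ Finset.range (m * p), a ℓ = m * ∑ ℓ ∈ Finset.range p, a ℓ := by
  induction m with
  | zero => simp
  | succ m ih =>
    have h : ∀ x, a (m * p + x) = a x := fun x => by
      rw [add_comm]; simpa using ha.nat_mul m x
    rw [Nat.succ_mul, Finset.sum_range_add, ih]
    simp only [h]
    push_cast
    ring

lemma sum_range_shift_of_periodic {a : ℕ → ℝ} {p : ℕ} (ha : Function.Periodic a p) (i : ℕ) :
    ∑ ℓ ∈ Finset.range p, a (ℓ + i) = ∑ ℓ ∈ Finset.range p, a ℓ := by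
  induction i with
  | zero => simp
  | succ i ih =>
    rw [← ih]
    have h := Finset.sum_range_succ (fun ℓ => a (ℓ + i)) p
    rw [Finset.sum_range_succ'] at h
    have hp : a (p + i) = a (0 + i) := by rw [add_comm p i, ha i, zero_add]
    have h' : ∀ ℓ, a (ℓ + (i + 1)) = a (ℓ + 1 + i) := fun ℓ => by congr 1; ring
    simp only [h']
    linarith

/-- If `a'` is dominated by the `p`-periodic `a` on `m` periods except within distance `L` of the
two ends, and by `C` everywhere, then its sum is controlled by that of `a`. -/
lemma sum_range_le_of_repetition {p m R L : ℕ} {C : ℝ} {a a' : ℕ → ℝ}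
    (ha : Function.Periodic a p) (ha₀ : ∀ ℓ, 0 ≤ a ℓ) (hC : 0 ≤ C)
    (ha' : ∀ ℓ < m * p + R, a' ℓ ≤ C) (h : ∀ ℓ, L ≤ ℓ → ℓ + L < m * p → a' ℓ ≤ a ℓ) :
    ∑ ℓ ∈ Finset.range (m * p + R), a' ℓ ≤
      m * ∑ ℓ ∈ Finset.range p, a ℓ + C * (R + 2 * L) := by
  have hend : ∑ x ∈ Finset.range R, a' (m * p + x) ≤ R * C := by
    have := Finset.sum_le_card_nsmul (Finset.range R) (fun x => a' (m * p + x)) C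
      fun x hx => ha' _ (by have := Finset.mem_range.1 hx; omega)
    simpa using this
  have hleft : ∑ ℓ ∈ Finset.range (m * p), (if ℓ < L then C else 0) ≤ L * C := by
    rw [← Finset.sum_filter, Finset.sum_const, nsmul_eq_mul]
    gcongr
    calc _ ≤ (Finset.range L).card := Finset.card_le_card fun x hx => by
            simp at hx ⊢; omega
      _ = L := Finset.card_range L
  have hright : ∑ ℓ ∈ Finset.range (m * p), (if m * p ≤ ℓ + L then C else 0) ≤ L * C := by
    rw [← Finset.sum_filter, Finset.sum_const, nsmul_eq_mul]
    gcongr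
    calc _ ≤ (Finset.Ico (m * p - L) (m * p)).card := Finset.card_le_card fun x hx => by
            simp at hx ⊢; omega
      _ ≤ L := by rw [Nat.card_Ico]; omega
  have hmain : ∑ ℓ ∈ Finset.range (m * p), a' ℓ ≤ ∑ ℓ ∈ Finset.range (m * p),
      (a ℓ + (if ℓ < L then C else 0) + (if m * p ≤ ℓ + L then C else 0)) := by
    refine Finset.sum_le_sum fun ℓ hℓ => ?_
    have h₁ := ha' ℓ (by have := Finset.mem_range.1 hℓ; omega)
    have h₂ := ha₀ ℓ
    have h₃ := h ℓ
    split_ifs with h₄ h₅ h₅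
    · linarith
    · linarith
    · linarith
    · linarith [h₃ (by omega) (by omega)]
  rw [Finset.sum_add_distrib, Finset.sum_add_distrib, sum_range_mul_of_periodic ha] at hmain
  rw [Finset.sum_range_add]
  linarith

namespace RepetitivePattern

variable {k : ℕ} {S : SkewSetup k} (P : RepetitivePattern S)

lemma π_cast_pos (n : ℕ) : (0 : ℝ) < P.π n := by exact_mod_cast P.π_pos n

lemma two_mul_π_le (n : ℕ) : 2 * P.π n ≤ P.π (n + 1) := by
  rw [P.period_eq]
  have := Nat.mul_le_mul_right (P.π n) (P.kseq_ge n)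
  omega

lemma tendsto_π : Tendsto P.π atTop atTop := by
  refine (strictMono_nat_of_lt_succ fun n => ?_).tendsto_atTop
  have := P.two_mul_π_le n
  have := P.π_pos n
  omega

/-- The average of a sequence over one period of the `n`-th orbit. -/
def orbitAvg (n : ℕ) (a : ℕ → ℝ) : ℝ := (∑ ℓ ∈ Finset.range (P.π n), a ℓ) / P.π n

/-- The number `λ_{n+1}`. -/
def lam (n : ℕ) : ℝ := (P.Rseq (n + 1) : ℝ) / (P.kseq (n + 1) * P.π n)

/-- Bounds the proportion of an orbit of level at least `n` which is not seen through a window of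
radius `L` as a part of the `n`-th orbit. -/
def defect (L n : ℕ) : ℝ := ∑' j, P.lam (j + n) + 2 * L / P.π n

lemma lam_nonneg (n : ℕ) : 0 ≤ P.lam n := by unfold lam; positivity

lemma defect_nonneg (L n : ℕ) : 0 ≤ P.defect L n :=
  add_nonneg (tsum_nonneg fun _ => P.lam_nonneg _) (by positivity)

lemma defect_succ_le (L n : ℕ) :
    P.lam n + 2 * L / P.π (n + 1) + P.defect L (n + 1) ≤ P.defect L n := by
  have hs : Summable fun j => P.lam (j + n) :=
    (summable_nat_add_iff n).2 P.lam_summable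
  have h₁ : ∑' j, P.lam (j + n) = P.lam n + ∑' j, P.lam (j + (n + 1)) := by
    rw [hs.tsum_eq_zero_add]
    simp only [zero_add]
    congr 2
    ext j
    congr 1
    ring
  have h₂ : (2 * L / P.π (n + 1) : ℝ) ≤ L / P.π n := by
    have : (2 * P.π n : ℝ) ≤ P.π (n + 1) := by exact_mod_cast P.two_mul_π_le n
    have := P.π_cast_pos n
    calc (2 * L / P.π (n + 1) : ℝ) ≤ 2 * L / (2 * P.π n) := by gcongr
      _ = L / P.π n := by field_simp
  have h₃ : (2 * L / P.π n : ℝ) = L / P.π n + L / P.π n := by ring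
  unfold defect
  rw [h₁, h₃]
  linarith

lemma tendsto_inv_π : Tendsto (fun n => (P.π n : ℝ)⁻¹) atTop (nhds 0) :=
  tendsto_inv_atTop_zero.comp (tendsto_natCast_atTop_atTop.comp P.tendsto_π)

lemma tendsto_defect (L : ℕ) : Tendsto (P.defect L) atTop (nhds 0) := by
  have h₂ := P.tendsto_inv_π.const_mul (2 * (L : ℝ))
  have h : P.defect L = fun n => ∑' j, P.lam (j + n) + 2 * L / P.π n := rfl
  simpa [h, div_eq_mul_inv] using (tendsto_sum_nat_add P.lam).add h₂

lemma orbitAvg_succ_le {n L : ℕ} {C : ℝ} {a a' : ℕ → ℝ}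
    (ha : Function.Periodic a (P.π n)) (ha₀ : ∀ ℓ, 0 ≤ a ℓ) (hC : 0 ≤ C)
    (ha' : ∀ ℓ < P.π (n + 1), a' ℓ ≤ C)
    (h : ∀ ℓ, L ≤ ℓ → ℓ + L < P.kseq (n + 1) * P.π n → a' ℓ ≤ a ℓ) :
    P.orbitAvg (n + 1) a' + C * P.defect L (n + 1) ≤ P.orbitAvg n a + C * P.defect L n := by
  have h₁ : P.orbitAvg (n + 1) a' ≤ P.orbitAvg n a + C * (P.lam n + 2 * L / P.π (n + 1)) := by
    have hs := sum_range_le_of_repetition (R := P.Rseq (n + 1)) ha ha₀ hC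
      (by rwa [← P.period_eq]) h
    rw [← P.period_eq] at hs
    have hA : 0 ≤ ∑ ℓ ∈ Finset.range (P.π n), a ℓ := Finset.sum_nonneg fun _ _ => ha₀ _
    set A := ∑ ℓ ∈ Finset.range (P.π n), a ℓ
    have hp := P.π_cast_pos n
    have hp' := P.π_cast_pos (n + 1)
    have hk : (0 : ℝ) < P.kseq (n + 1) := by
      have := P.kseq_ge n
      exact_mod_cast (by omega : 0 < P.kseq (n + 1))
    have hle : (P.kseq (n + 1) * P.π n : ℝ) ≤ P.π (n + 1) := by
      exact_mod_cast (by rw [P.period_eq]; omega)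
    calc P.orbitAvg (n + 1) a'
        ≤ (P.kseq (n + 1) * A + C * (P.Rseq (n + 1) + 2 * L)) / P.π (n + 1) := by
          unfold orbitAvg; gcongr
      _ = P.kseq (n + 1) * A / P.π (n + 1) +
          C * (P.Rseq (n + 1) / P.π (n + 1) + 2 * L / P.π (n + 1)) := by ring
      _ ≤ P.kseq (n + 1) * A / (P.kseq (n + 1) * P.π n) +
          C * (P.Rseq (n + 1) / (P.kseq (n + 1) * P.π n) + 2 * L / P.π (n + 1)) := by gcongr
      _ = _ := by
        unfold orbitAvg lam
        rw [mul_div_mul_left _ _ hk.ne']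
  have h₂ := mul_le_mul_of_nonneg_left (P.defect_succ_le L n) hC
  linarith

lemma orbitAvg_add_le {N L : ℕ} {C : ℝ} {a : ℕ → ℕ → ℝ}
    (ha : ∀ j, Function.Periodic (a j) (P.π (N + j))) (ha₀ : ∀ j ℓ, 0 ≤ a j ℓ) (hC : 0 ≤ C)
    (ha' : ∀ j ℓ, a j ℓ ≤ C)
    (h : ∀ j ℓ, L ≤ ℓ → ℓ + L < P.kseq (N + j + 1) * P.π (N + j) → a (j + 1) ℓ ≤ a j ℓ) (j : ℕ) :
    P.orbitAvg (N + j) (a j) ≤ P.orbitAvg N (a 0) + C * P.defect L N := by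
  have key : P.orbitAvg (N + j) (a j) + C * P.defect L (N + j) ≤
      P.orbitAvg N (a 0) + C * P.defect L N := by
    induction j with
    | zero => simp
    | succ j ih =>
      exact (P.orbitAvg_succ_le (n := N + j) (ha j) (ha₀ j) hC (fun ℓ _ => ha' _ ℓ) (h j)).trans ih
  have := mul_nonneg hC (P.defect_nonneg L (N + j))
  linarith

/-- The points of the `n`-th orbit. -/
def orb (n ℓ : ℕ) : Shift k := (shiftMap k)^[ℓ] (P.ξp n)

lemma orb_apply (n ℓ : ℕ) (i : ℤ) : P.orb n ℓ i = P.ξp n (i + ℓ) := shiftMap_iterate_apply ..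

lemma iterate_orb (n ℓ i : ℕ) : (shiftMap k)^[i] (P.orb n ℓ) = P.orb n (ℓ + i) := by
  rw [orb, orb, add_comm, Function.iterate_add_apply]

lemma orb_periodic (n : ℕ) : Function.Periodic (P.orb n) (P.π n) := fun ℓ => by
  ext i
  rw [orb_apply, orb_apply, ξp, ξp]
  congr 3
  push_cast
  rw [← add_assoc, Int.add_emod_right]

lemma ξp_natCast (n i : ℕ) : P.ξp n i = P.w n (i % P.π n) := by
  rw [ξp, ← Int.natCast_mod, Int.toNat_natCast]

lemma orb_succ_apply {n ℓ L : ℕ} (h₁ : L ≤ ℓ) (h₂ : ℓ + L < P.kseq (n + 1) * P.π n) {i : ℤ}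
    (hi : i ∈ Icc (-L : ℤ) L) : P.orb (n + 1) ℓ i = P.orb n ℓ i := by
  obtain ⟨hi₁, hi₂⟩ := hi
  obtain ⟨t, ht⟩ : ∃ t : ℕ, i + ℓ = t := ⟨(i + ℓ).toNat, by omega⟩
  have ht' : t < P.kseq (n + 1) * P.π n := by zify at h₂ ⊢; omega
  have ht'' : t < P.π (n + 1) := by rw [P.period_eq]; omega
  rw [orb_apply, orb_apply, ht, ξp_natCast, ξp_natCast, Nat.mod_eq_of_lt ht'', P.word_eq n t ht']

lemma apply_orb_succ {α : Type*} {n ℓ L : ℕ} {φ : Shift k → α}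
    (hφ : DependsOn φ (Icc (-L : ℤ) L)) (h₁ : L ≤ ℓ) (h₂ : ℓ + L < P.kseq (n + 1) * P.π n) :
    φ (P.orb (n + 1) ℓ) = φ (P.orb n ℓ) :=
  hφ fun _ hi => P.orb_succ_apply h₁ h₂ hi

/-- The mean of `g` along the `n`-th orbit. -/
def mean (n : ℕ) (g : Shift k → ℝ) : ℝ := P.orbitAvg n fun ℓ => g (P.orb n ℓ)

lemma orbitAvg_mono {n : ℕ} {a b : ℕ → ℝ} (h : ∀ ℓ, a ℓ ≤ b ℓ) :
    P.orbitAvg n a ≤ P.orbitAvg n b := by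
  unfold orbitAvg
  gcongr
  exact h _

lemma orbitAvg_const (n : ℕ) (c : ℝ) : P.orbitAvg n (fun _ => c) = c := by
  have := P.π_cast_pos n
  simp [orbitAvg]
  field_simp

lemma orbitAvg_sub (n : ℕ) (a b : ℕ → ℝ) :
    P.orbitAvg n (fun ℓ => a ℓ - b ℓ) = P.orbitAvg n a - P.orbitAvg n b := by
  simp [orbitAvg, Finset.sum_sub_distrib, sub_div]

lemma abs_orbitAvg_le (n : ℕ) (a : ℕ → ℝ) : |P.orbitAvg n a| ≤ P.orbitAvg n fun ℓ => |a ℓ| := by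
  unfold orbitAvg
  rw [abs_div, abs_of_pos (P.π_cast_pos n)]
  gcongr
  exact Finset.abs_sum_le_sum_abs _ _

lemma abs_mean_le {n : ℕ} {g : Shift k → ℝ} {C : ℝ} (hg : ∀ x, |g x| ≤ C) : |P.mean n g| ≤ C :=
  (P.abs_orbitAvg_le n _).trans ((P.orbitAvg_mono fun _ => hg _).trans (P.orbitAvg_const n C).le)

lemma orbitAvg_birkhoff {n : ℕ} {a : ℕ → ℝ} (ha : Function.Periodic a (P.π n)) {T : ℕ}
    (hT : 0 < T) : P.orbitAvg n (fun ℓ => (∑ i ∈ Finset.range T, a (ℓ + i)) / T) =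
      P.orbitAvg n a := by
  unfold orbitAvg
  rw [← Finset.sum_div, Finset.sum_comm]
  simp_rw [sum_range_shift_of_periodic ha]
  have : (T : ℝ) ≠ 0 := by positivity
  simp
  field_simp

/-- Partial sums of `g - mean N g` along the `N`-th orbit, transported to the later orbits: they are
repeated along the copies of the `N`-th word and vanish on the spacers. -/
def corrector (g : Shift k → ℝ) (N : ℕ) : ℕ → ℕ → ℝ
  | 0 => fun t => ∑ i ∈ Finset.range t, (g (P.orb N i) - P.mean N g)
  | j + 1 => fun t => if t % P.π (N + j + 1) ≤ P.kseq (N + j + 1) * P.π (N + j) then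
      corrector g N j (t % P.π (N + j + 1)) else 0

lemma corrector_periodic (g : Shift k → ℝ) (N j : ℕ) :
    Function.Periodic (P.corrector g N j) (P.π (N + j)) := by
  cases j with
  | zero =>
    intro t
    have hper : Function.Periodic (fun i => g (P.orb N i) - P.mean N g) (P.π N) := fun i => by
      simp only [P.orb_periodic N i]
    have h := sum_range_shift_of_periodic hper t
    have h₀ : ∑ i ∈ Finset.range (P.π N), (g (P.orb N i) - P.mean N g) = 0 := by
      have := P.π_cast_pos N
      simp [mean, orbitAvg, Finset.sum_sub_distrib]
      field_simp
      simp
    simp only [corrector, add_zero]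
    rw [Finset.sum_range_add]
    simp only [add_comm t, h, h₀, add_zero]
  | succ j => intro t; simp [corrector, ← add_assoc]

lemma corrector_zero (g : Shift k → ℝ) (N j : ℕ) : P.corrector g N j 0 = 0 := by
  induction j with
  | zero => simp [corrector]
  | succ j ih => simp [corrector, ih]

lemma corrector_mul_π (g : Shift k → ℝ) (N j m : ℕ) :
    P.corrector g N j (m * P.π (N + j)) = 0 := by
  rw [← (P.corrector_periodic g N j).map_mod_nat, Nat.mul_mod_left, corrector_zero]

lemma corrector_succ_of_le (g : Shift k → ℝ) (N j : ℕ) {t : ℕ}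
    (ht : t ≤ P.kseq (N + j + 1) * P.π (N + j)) :
    P.corrector g N (j + 1) t = P.corrector g N j t := by
  have h := P.period_eq (N + j)
  have h' := P.Rseq_ge (N + j)
  simp [corrector, Nat.mod_eq_of_lt (by omega : t < P.π (N + j + 1)), ht]

lemma corrector_succ_of_ge (g : Shift k → ℝ) (N j : ℕ) {t : ℕ}
    (ht : P.kseq (N + j + 1) * P.π (N + j) ≤ t) (ht' : t ≤ P.π (N + j + 1)) :
    P.corrector g N (j + 1) t = 0 := by
  rcases ht.eq_or_lt with rfl | ht
  · rw [corrector_succ_of_le _ _ _ _ le_rfl, corrector_mul_π]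
  rcases ht'.eq_or_lt with rfl | ht'
  · simpa [add_assoc] using P.corrector_mul_π g N (j + 1) 1
  · simp [corrector, Nat.mod_eq_of_lt ht', ht.not_ge]

section

variable {g : Shift k → ℝ} {C : ℝ} (hg : ∀ x, |g x| ≤ C)
include hg

lemma abs_sub_mean_le (n : ℕ) (x : Shift k) : |g x - P.mean n g| ≤ 2 * C := by
  have := abs_sub (g x) (P.mean n g)
  have := hg x
  have := P.abs_mean_le (n := n) hg
  linarith

lemma abs_corrector_le (N j t : ℕ) : |P.corrector g N j t| ≤ P.π N * (2 * C) := by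
  have hC : 0 ≤ C := (abs_nonneg _).trans (hg (P.orb 0 0))
  induction j generalizing t with
  | zero =>
    rw [← (P.corrector_periodic g N 0).map_mod_nat]
    have ht := Nat.mod_lt t (P.π_pos N)
    simp only [corrector, add_zero]
    calc _ ≤ ∑ i ∈ Finset.range (t % P.π N), |g (P.orb N i) - P.mean N g| :=
          Finset.abs_sum_le_sum_abs _ _
      _ ≤ ∑ i ∈ Finset.range (t % P.π N), 2 * C :=
          Finset.sum_le_sum fun i _ => P.abs_sub_mean_le hg N _
      _ = ((t % P.π N : ℕ) : ℝ) * (2 * C) := by simp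
      _ ≤ _ := by gcongr
  | succ j ih =>
    simp only [corrector]
    split_ifs
    · exact ih _
    · simp; positivity

lemma abs_corrector_succ_sub_le (N j t : ℕ) :
    |P.corrector g N j (t + 1) - P.corrector g N j t| ≤ 2 * C := by
  have hC : 0 ≤ C := (abs_nonneg _).trans (hg (P.orb 0 0))
  induction j generalizing t with
  | zero => simpa [corrector, Finset.sum_range_succ, -Finset.sum_sub_distrib] using P.abs_sub_mean_le hg N (P.orb N t)
  | succ j ih =>
    have hper : Function.Periodic
        (fun t => |P.corrector g N (j + 1) (t + 1) - P.corrector g N (j + 1) t|)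
        (P.π (N + j + 1)) := fun t => by
      have h := P.corrector_periodic g N (j + 1)
      rw [← add_assoc] at h
      simp only [h t, ← h (t + 1)]
      congr 3
      ring
    have ht := Nat.mod_lt t (P.π_pos (N + j + 1))
    rw [← hper.map_mod_nat t]
    set r := t % P.π (N + j + 1)
    rcases lt_or_ge r (P.kseq (N + j + 1) * P.π (N + j)) with h | h
    · simp only [corrector_succ_of_le _ _ _ _ h.le, corrector_succ_of_le _ _ _ _ h]
      exact ih r
    · simp only [corrector_succ_of_ge _ _ _ _ h ht.le,
        corrector_succ_of_ge _ _ _ _ (h.trans r.le_succ) ht]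
      simpa using hC

lemma orbitAvg_birkhoff_sub_mean_le {L : ℕ} (hL : DependsOn g (Icc (-L : ℤ) L)) (N j : ℕ) {T : ℕ}
    (hT : 0 < T) :
    P.orbitAvg (N + j) (fun ℓ =>
      |(∑ i ∈ Finset.range T, g (P.orb (N + j) (ℓ + i))) / T - P.mean N g|) ≤
      4 * C * P.π N / T + 4 * C * P.defect L N := by
  have hC : 0 ≤ C := (abs_nonneg _).trans (hg (P.orb 0 0))
  have hT' : (0 : ℝ) < T := by exact_mod_cast hT
  let U := P.corrector g N
  let b : ℕ → ℕ → ℝ := fun j ℓ => g (P.orb (N + j) ℓ) - P.mean N g - (U j (ℓ + 1) - U j ℓ)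
  let a : ℕ → ℕ → ℝ := fun j ℓ => |b j ℓ|
  have ha : ∀ j, Function.Periodic (a j) (P.π (N + j)) := fun j ℓ => by
    have h := P.corrector_periodic g N j
    simp only [a, b, U, P.orb_periodic (N + j) ℓ, h ℓ, ← h (ℓ + 1)]
    congr 4
    ring
  have ha_le : ∀ j ℓ, a j ℓ ≤ 4 * C := fun j ℓ => by
    have h₁ := P.abs_sub_mean_le hg N (P.orb (N + j) ℓ)
    have h₂ := P.abs_corrector_succ_sub_le hg N j ℓ
    have h₃ := abs_sub (g (P.orb (N + j) ℓ) - P.mean N g) (U j (ℓ + 1) - U j ℓ)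
    simp only [a, b, U] at *
    linarith
  have hstep : ∀ j ℓ, L ≤ ℓ → ℓ + L < P.kseq (N + j + 1) * P.π (N + j) →
      a (j + 1) ℓ ≤ a j ℓ := fun j ℓ h₁ h₂ => by
    have h₃ : g (P.orb (N + (j + 1)) ℓ) = g (P.orb (N + j) ℓ) := P.apply_orb_succ hL h₁ h₂
    simp only [a, b, U, h₃]
    rw [corrector_succ_of_le _ _ _ _ (by omega), corrector_succ_of_le _ _ _ _ (by omega)]
  have ha0 : P.orbitAvg N (a 0) = 0 := by
    have : a 0 = fun _ => 0 := by
      ext ℓ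
      simp [a, b, U, corrector, Finset.sum_range_succ, -Finset.sum_sub_distrib]
    rw [this, orbitAvg_const]
  have hmain := P.orbitAvg_add_le ha (fun _ _ => abs_nonneg _) (by positivity) ha_le hstep j
  rw [ha0, zero_add] at hmain
  have hpt : ∀ ℓ, |(∑ i ∈ Finset.range T, g (P.orb (N + j) (ℓ + i))) / T - P.mean N g| -
      4 * C * P.π N / T ≤ (∑ i ∈ Finset.range T, a j (ℓ + i)) / T := fun ℓ => by
    have h₁ : (∑ i ∈ Finset.range T, g (P.orb (N + j) (ℓ + i))) / T - P.mean N g =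
        (U j (ℓ + T) - U j ℓ) / T + (∑ i ∈ Finset.range T, b j (ℓ + i)) / T := by
      have h := Finset.sum_range_sub (fun i => U j (ℓ + i)) T
      simp only [add_zero, ← add_assoc] at h
      simp only [b, Finset.sum_sub_distrib (f := fun i => g (P.orb (N + j) (ℓ + i)) - P.mean N g)]
      rw [h, Finset.sum_sub_distrib]
      simp
      field_simp
      ring
    have h₂ : |U j (ℓ + T) - U j ℓ| ≤ 4 * C * P.π N := by
      have h₃ := P.abs_corrector_le hg N j (ℓ + T)
      have h₄ := P.abs_corrector_le hg N j ℓ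
      have h₅ := abs_sub (U j (ℓ + T)) (U j ℓ)
      simp only [U] at *
      linarith
    rw [h₁, sub_le_iff_le_add']
    refine (abs_add_le _ _).trans (add_le_add ?_ ?_)
    · rw [abs_div, abs_of_pos hT']
      gcongr
    · rw [abs_div, abs_of_pos hT']
      gcongr
      exact Finset.abs_sum_le_sum_abs _ _
  have := P.orbitAvg_mono (n := N + j) hpt
  rw [orbitAvg_sub, orbitAvg_const, P.orbitAvg_birkhoff (ha j) hT] at this
  linarith

lemma abs_mean_sub_mean_le {L : ℕ} (hL : DependsOn g (Icc (-L : ℤ) L)) (N j : ℕ) :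
    |P.mean (N + j) g - P.mean N g| ≤ 4 * C * P.defect L N := by
  have h : ∀ T : ℕ, 0 < T → |P.mean (N + j) g - P.mean N g| ≤
      4 * C * P.π N / T + 4 * C * P.defect L N := fun T hT => by
    refine le_trans ?_ (P.orbitAvg_birkhoff_sub_mean_le hg hL N j hT)
    refine le_trans (le_of_eq ?_) (P.abs_orbitAvg_le _ _)
    have hper : Function.Periodic (fun ℓ => g (P.orb (N + j) ℓ)) (P.π (N + j)) := fun ℓ => by
      simp only [P.orb_periodic (N + j) ℓ]
    rw [orbitAvg_sub, orbitAvg_const, P.orbitAvg_birkhoff hper hT, mean]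
  have hlim := (tendsto_const_div_atTop_nhds_zero_nat (4 * C * P.π N)).add_const
    (4 * C * P.defect L N)
  rw [zero_add] at hlim
  exact ge_of_tendsto hlim ((eventually_gt_atTop 0).mono h)

end

lemma integral_νX (n : ℕ) (g : Shift k → ℝ) : ∫ x, g x ∂(P.νX n) = P.mean n g := by
  rw [νX, integral_smul_measure, integral_finsetSum_measure fun _ _ => integrable_dirac (by simp)]
  simp [mean, orbitAvg, orb, div_eq_inv_mul]

instance (n : ℕ) : IsProbabilityMeasure (P.νX n) := by
  refine ⟨?_⟩
  have : (P.π n : ℝ≥0∞) ≠ 0 := by exact_mod_cast (P.π_pos n).ne'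
  simp [νX, ENNReal.inv_mul_cancel this]

lemma mean_comp_shiftMap (n : ℕ) (g : Shift k → ℝ) :
    P.mean n (fun x => g (shiftMap k x)) = P.mean n g := by
  have hper : Function.Periodic (fun ℓ => g (P.orb n ℓ)) (P.π n) := fun ℓ => by
    simp only [P.orb_periodic n ℓ]
  have h := sum_range_shift_of_periodic hper 1
  simp only [mean, orbitAvg, ← h]
  congr 2
  ext ℓ
  rw [← P.iterate_orb n ℓ 1]
  rfl

end RepetitivePattern

lemma exists_forall_abs_le {k : ℕ} (g : C(Shift k, ℝ)) : ∃ C, 0 < C ∧ ∀ x, |g x| ≤ C := by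
  obtain ⟨C, hC⟩ := (isCompact_range g.continuous).isBounded.exists_norm_le
  exact ⟨max C 1, by positivity, fun x => (hC _ ⟨x, rfl⟩).trans (le_max_left _ _)⟩

lemma DependsOn.continuous_of_finite {k : ℕ} {β : Type*} [TopologicalSpace β] {s : Set ℤ}
    (hs : s.Finite) {φ : Shift k → β} (hφ : DependsOn φ s) : Continuous φ := by
  rcases isEmpty_or_nonempty (Shift k) with _ | ⟨⟨x₀⟩⟩
  · exact continuous_of_discreteTopology
  have : Nonempty β := ⟨φ x₀⟩
  have : Finite s := hs
  obtain ⟨ψ, rfl⟩ := dependsOn_iff_exists_comp.1 hφ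
  exact (continuous_of_discreteTopology (f := ψ)).comp (Pi.continuous_domRestrict s)

lemma exists_dependsOn_abs_sub_le {k : ℕ} (g : C(Shift k, ℝ)) {ε : ℝ} (hε : 0 < ε) :
    ∃ (L : ℕ) (h : C(Shift k, ℝ)), DependsOn h (Icc (-L : ℤ) L) ∧ ∀ x, |g x - h x| ≤ ε := by
  rcases isEmpty_or_nonempty (Shift k) with _ | ⟨⟨x₀⟩⟩
  · exact ⟨0, g, fun x => isEmptyElim x, fun x => isEmptyElim x⟩
  let tr : ℕ → Shift k → Shift k := fun L x i => if i ∈ Icc (-L : ℤ) L then x i else x₀ i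
  have htr : ∀ L, DependsOn (tr L) (Icc (-L : ℤ) L) := fun L x y hxy => by
    ext i
    simp only [tr]
    split_ifs with hi
    · rw [hxy i hi]
    · rfl
  by_contra! hcon
  have hbad : ∀ L, ∃ x, ε < |g x - g (tr L x)| := fun L =>
    hcon L ⟨fun x => g (tr L x), g.continuous.comp ((htr L).continuous_of_finite (finite_Icc _ _))⟩
      fun x y hxy => congrArg g (htr L hxy)
  choose x hx using hbad
  obtain ⟨y, φ, hφ, hy⟩ := CompactSpace.tendsto_subseq x
  have hy' : Tendsto (fun n => tr (φ n) (x (φ n))) atTop (nhds y) := by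
    rw [tendsto_pi_nhds] at hy ⊢
    intro i
    refine (hy i).congr' ?_
    filter_upwards [hφ.tendsto_atTop.eventually_ge_atTop i.natAbs] with n hn
    have : i ∈ Icc (-(φ n : ℕ) : ℤ) (φ n) := ⟨by omega, by omega⟩
    simp [tr, this.1, this.2]
  have hlim := (((g.continuous.tendsto y).comp hy).sub ((g.continuous.tendsto y).comp hy')).abs
  rw [sub_self, abs_zero] at hlim
  exact hε.not_ge (ge_of_tendsto' hlim fun n => (hx (φ n)).le)

namespace RepetitivePattern

variable {k : ℕ} {S : SkewSetup k} (P : RepetitivePattern S)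

lemma abs_mean_sub_le {g h : Shift k → ℝ} {ε : ℝ} (hgh : ∀ x, |g x - h x| ≤ ε) (n : ℕ) :
    |P.mean n g - P.mean n h| ≤ ε := by
  rw [mean, mean, ← orbitAvg_sub]
  exact P.abs_mean_le (g := fun x => g x - h x) hgh

lemma cauchySeq_mean (g : C(Shift k, ℝ)) : CauchySeq fun n => P.mean n g := by
  refine Metric.cauchySeq_iff'.2 fun ε hε => ?_
  obtain ⟨L, h, hL, hgh⟩ := exists_dependsOn_abs_sub_le g (by positivity : 0 < ε / 4)
  obtain ⟨C, hC, hh⟩ := exists_forall_abs_le h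
  have hlim := (P.tendsto_defect L).const_mul (4 * C)
  rw [mul_zero] at hlim
  obtain ⟨N, hN⟩ := (hlim.eventually_lt_const (by positivity : 0 < ε / 4)).exists
  refine ⟨N, fun n hn => ?_⟩
  obtain ⟨j, rfl⟩ := Nat.exists_eq_add_of_le hn
  have h₁ := abs_le.1 (P.abs_mean_sub_mean_le hh hL N j)
  have h₂ := abs_le.1 (P.abs_mean_sub_le hgh N)
  have h₃ := abs_le.1 (P.abs_mean_sub_le hgh (N + j))
  rw [Real.dist_eq, abs_lt]
  constructor <;> linarith

lemma exists_limit :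
    ∃ ν : Measure (Shift k), IsProbabilityMeasure ν ∧ WeakStarTendsto (fun n => P.νX n) ν := by
  let p : ℕ → ProbabilityMeasure (Shift k) := fun n => ⟨P.νX n, inferInstance⟩
  obtain ⟨ν, hν⟩ : ∃ ν, Tendsto p (hyperfilter ℕ) (nhds ν) :=
    ⟨_, ((hyperfilter ℕ).map p).le_nhds_lim⟩
  refine ⟨ν, inferInstance, fun g => ?_⟩
  obtain ⟨c, hc⟩ := cauchySeq_tendsto_of_complete (P.cauchySeq_mean g)
  have h := ProbabilityMeasure.tendsto_iff_forall_integral_tendsto.1 hν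
    (BoundedContinuousFunction.mkOfCompact g)
  simp only [integral_νX]
  simp only [p, BoundedContinuousFunction.mkOfCompact_apply, ProbabilityMeasure.coe_mk,
    integral_νX] at h
  rwa [tendsto_nhds_unique h (hc.mono_left Nat.hyperfilter_le_atTop)]

section

variable {ν : Measure (Shift k)} (hν : WeakStarTendsto (fun n => P.νX n) ν)
include hν

lemma tendsto_mean (g : C(Shift k, ℝ)) :
    Tendsto (fun n => P.mean n g) atTop (nhds (∫ x, g x ∂ν)) := by
  simpa only [integral_νX] using hν g

lemma integral_birkhoff_sub_mean_le {g : C(Shift k, ℝ)} {C : ℝ} (hg : ∀ x, |g x| ≤ C) {L : ℕ}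
    (hL : DependsOn g (Icc (-L : ℤ) L)) (N : ℕ) {T : ℕ} (hT : 0 < T) :
    ∫ x, |(∑ i ∈ Finset.range T, g ((shiftMap k)^[i] x)) / T - P.mean N g| ∂ν ≤
      4 * C * P.π N / T + 4 * C * P.defect L N := by
  have hcont : Continuous fun x =>
      |(∑ i ∈ Finset.range T, g ((shiftMap k)^[i] x)) / T - P.mean N g| := by
    have := fun i : ℕ => g.continuous.comp ((continuous_shiftMap k).iterate i)
    simp only [Function.comp_def] at this
    exact (((continuous_finsetSum _ fun i _ => this i).div_const _).sub continuous_const).abs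
  have h := (P.tendsto_mean hν ⟨_, hcont⟩).comp (tendsto_add_atTop_nat N)
  refine le_of_tendsto' h fun j => ?_
  simp only [Function.comp, mean, ContinuousMap.coe_mk, iterate_orb]
  rw [add_comm j N]
  exact P.orbitAvg_birkhoff_sub_mean_le hg hL N j hT

variable [IsProbabilityMeasure ν]

lemma measurePreserving_limit : MeasurePreserving (shiftMap k) ν ν := by
  have hm := (continuous_shiftMap k).measurable
  have := Measure.isProbabilityMeasure_map (μ := ν) hm.aemeasurable
  refine ⟨hm, ext_of_forall_integral_eq_of_IsFiniteMeasure fun g => ?_⟩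
  rw [integral_map hm.aemeasurable g.continuous.aestronglyMeasurable]
  have h₁ := P.tendsto_mean hν ⟨fun x => g (shiftMap k x), g.continuous.comp (continuous_shiftMap k)⟩
  have h₂ := P.tendsto_mean hν g.toContinuousMap
  simp only [ContinuousMap.coe_mk, P.mean_comp_shiftMap] at h₁
  exact tendsto_nhds_unique h₁ h₂

end

end RepetitivePattern

lemma exists_dependsOn_integral_sub_le {k : ℕ} {ν : Measure (Shift k)} [IsProbabilityMeasure ν]
    {f : Shift k → ℝ} (hf : Integrable f ν) {ε : ℝ} (hε : 0 < ε) :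
    ∃ (L : ℕ) (h : C(Shift k, ℝ)), DependsOn h (Icc (-L : ℤ) L) ∧ ∫ x, |f x - h x| ∂ν ≤ ε := by
  obtain ⟨g, hg, hgi⟩ := hf.exists_boundedContinuous_integral_sub_le (half_pos hε)
  obtain ⟨L, h, hL, hgh⟩ := exists_dependsOn_abs_sub_le g.toContinuousMap (half_pos hε)
  refine ⟨L, h, hL, ?_⟩
  obtain ⟨C, -, hC⟩ := exists_forall_abs_le h
  have hi : Integrable (fun x => |f x - g x|) ν := (hf.sub hgi).abs
  have hhi : Integrable h ν := .of_bound h.continuous.aestronglyMeasurable C (.of_forall hC)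
  calc ∫ x, |f x - h x| ∂ν ≤ ∫ x, (|f x - g x| + ε / 2) ∂ν :=
        integral_mono (hf.sub hhi).abs (hi.add (integrable_const _)) fun x =>
          (abs_sub_le _ (g x) _).trans (add_le_add_right (hgh x) _)
    _ = ∫ x, |f x - g x| ∂ν + ε / 2 := by
        rw [integral_add hi (integrable_const _)]; simp
    _ ≤ ε := by
        simp only [Real.norm_eq_abs] at hg
        linarith

lemma Real.negMulLog_le_mul_neg_log_add {p q : ℝ} (hp : 0 ≤ p) (hq : 0 < q) :
    Real.negMulLog p ≤ p * -Real.log q + (q - p) := by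
  rcases hp.eq_or_lt with rfl | hp
  · simp [hq.le]
  · have h := mul_le_mul_of_nonneg_left (Real.log_le_sub_one_of_pos (div_pos hq hp)) hp.le
    rw [Real.log_div hq.ne' hp.ne', mul_sub, mul_sub, mul_div_cancel₀ _ hp.ne'] at h
    rw [Real.negMulLog]
    linarith

/-- Gibbs' inequality for a finite-valued random variable. -/
lemma sum_negMulLog_le_integral {X ι : Type*} [MeasurableSpace X] [Fintype ι] [MeasurableSpace ι]
    [MeasurableSingletonClass ι] {ν : Measure X} [IsProbabilityMeasure ν] {F : X → ι}
    (hF : Measurable F) {q : ι → ℝ} (hq : ∀ s, 0 < q s) (hq₁ : ∑ s, q s ≤ 1) {G : X → ℝ}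
    (hG : Integrable G ν) (h : ∀ x, -Real.log (q (F x)) ≤ G x) :
    ∑ s, Real.negMulLog (ν (F ⁻¹' {s})).toReal ≤ ∫ x, G x ∂ν := by
  have := Measure.isProbabilityMeasure_map (μ := ν) hF.aemeasurable
  have hp : ∀ s, (ν.map F).real {s} = (ν (F ⁻¹' {s})).toReal := fun s => by
    rw [Measure.real, Measure.map_apply hF (measurableSet_singleton s)]
  have hsum : ∑ s, (ν.map F).real {s} = 1 := by
    simp
  have hint : Integrable (fun x => -Real.log (q (F x))) ν :=
    (Integrable.of_finite (μ := ν.map F) (f := fun s => -Real.log (q s))).comp_measurable hF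
  calc ∑ s, Real.negMulLog (ν (F ⁻¹' {s})).toReal
      ≤ ∑ s, ((ν.map F).real {s} * -Real.log (q s) + (q s - (ν.map F).real {s})) :=
        Finset.sum_le_sum fun s _ => by
          rw [← hp]; exact Real.negMulLog_le_mul_neg_log_add measureReal_nonneg (hq s)
    _ = ∑ s, (ν.map F).real {s} * -Real.log (q s) + (∑ s, q s - 1) := by
        rw [Finset.sum_add_distrib, Finset.sum_sub_distrib, hsum]
    _ ≤ ∑ s, (ν.map F).real {s} * -Real.log (q s) := by linarith
    _ = ∫ s, -Real.log (q s) ∂(ν.map F) := by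
        rw [integral_fintype .of_finite]; rfl
    _ = ∫ x, -Real.log (q (F x)) ∂ν := integral_map hF.aemeasurable
        (Integrable.of_finite (μ := ν.map F)).aestronglyMeasurable
    _ ≤ ∫ x, G x ∂ν := integral_mono hint hG h

/-- The law of a uniformly chosen word among `y 0, …, y (p - 1)`, perturbed independently at
each place. -/
def noisyWordLaw {m n : ℕ} (α β : ℝ) (p : ℕ) (y : ℕ → Fin n → Fin m) (s : Fin n → Fin m) : ℝ :=
  (∑ ℓ ∈ Finset.range p, ∏ i, if s i = y ℓ i then α else β) / p

section

variable {m n p : ℕ} {α β : ℝ} (y : ℕ → Fin n → Fin m)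

lemma noisyWordLaw_pos (hα : 0 < α) (hβ : 0 < β) (hp : 0 < p) (s : Fin n → Fin m) :
    0 < noisyWordLaw α β p y s := by
  have : (0 : ℝ) < p := by exact_mod_cast hp
  refine div_pos (Finset.sum_pos (fun ℓ _ => Finset.prod_pos fun i _ => ?_) (by simp; omega)) this
  split_ifs <;> assumption

lemma sum_noisyWordLaw_le_one (hα : 0 < α) (hβ : 0 < β) (hαβ : α + m * β ≤ 1) :
    ∑ s, noisyWordLaw α β p y s ≤ 1 := by
  have hletter : ∀ b : Fin m, ∑ a, (if a = b then α else β) ≤ 1 := fun b => by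
    refine le_trans ?_ hαβ
    calc ∑ a, (if a = b then α else β) ≤ ∑ a, ((if a = b then α else 0) + β) :=
          Finset.sum_le_sum fun a _ => by split_ifs <;> linarith
      _ = α + m * β := by simp [Finset.sum_add_distrib]
  have hword : ∀ ℓ, ∑ s : Fin n → Fin m, ∏ i, (if s i = y ℓ i then α else β) ≤ 1 := fun ℓ => by
    have h := Finset.prod_univ_sum (fun _ : Fin n => (Finset.univ : Finset (Fin m)))
      (fun i a => if a = y ℓ i then α else β)
    rw [Fintype.piFinset_univ] at h
    rw [← h]
    exact Finset.prod_le_one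
      (fun i _ => Finset.sum_nonneg fun a _ => by split_ifs <;> positivity) fun i _ => hletter _
  simp only [noisyWordLaw]
  rw [← Finset.sum_div, Finset.sum_comm]
  refine div_le_one_of_le₀ ?_ (Nat.cast_nonneg p)
  simpa using Finset.sum_le_sum fun ℓ (_ : ℓ ∈ Finset.range p) => hword ℓ

lemma neg_log_noisyWordLaw_le (hα : 0 < α) (hβ : 0 < β) (hα₁ : α ≤ 1) {ℓ : ℕ} (hℓ : ℓ < p)
    (s : Fin n → Fin m) :
    -Real.log (noisyWordLaw α β p y s) ≤ Real.log p + n * -Real.log α +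
      ∑ i, (if s i = y ℓ i then 0 else -Real.log β) := by
  have hp : (0 : ℝ) < p := by exact_mod_cast (by omega : 0 < p)
  have hpos : ∀ i, 0 < if s i = y ℓ i then α else β := fun i => by split_ifs <;> assumption
  have hle : ∏ i, (if s i = y ℓ i then α else β) ≤
      ∑ ℓ ∈ Finset.range p, ∏ i, (if s i = y ℓ i then α else β) :=
    Finset.single_le_sum (f := fun ℓ => ∏ i, (if s i = y ℓ i then α else β))
      (fun ℓ _ => Finset.prod_nonneg fun i _ => by split_ifs <;> positivity)
      (Finset.mem_range.2 hℓ)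
  have hprod : 0 < ∏ i, (if s i = y ℓ i then α else β) := Finset.prod_pos fun i _ => hpos i
  have hlog := Real.log_le_log hprod hle
  rw [Real.log_prod fun i _ => (hpos i).ne'] at hlog
  rw [noisyWordLaw, Real.log_div (hprod.trans_le hle).ne' hp.ne']
  have hsum : ∑ i, -Real.log (if s i = y ℓ i then α else β) ≤
      ∑ i, (-Real.log α + (if s i = y ℓ i then 0 else -Real.log β)) :=
    Finset.sum_le_sum fun i _ => by
      have := Real.log_nonpos hα.le hα₁
      split_ifs <;> linarith
  rw [Finset.sum_add_distrib, Finset.sum_neg_distrib] at hsum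
  simp at hsum ⊢
  linarith

end

namespace RepetitivePattern

variable {k : ℕ} {S : SkewSetup k} (P : RepetitivePattern S) {ν : Measure (Shift k)}
  [IsProbabilityMeasure ν] (hν : WeakStarTendsto (fun n => P.νX n) ν)
include hν

lemma ergodic_limit : Ergodic (shiftMap k) ν := by
  classical
  have hmp := P.measurePreserving_limit hν
  refine ⟨hmp, ⟨fun s hs hinv => ?_⟩⟩
  have hiter : ∀ i x, (shiftMap k)^[i] x ∈ s ↔ x ∈ s := fun i x => by
    induction i generalizing x with
    | zero => rfl
    | succ i ih =>
      rw [Function.iterate_succ_apply, ih]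
      exact (Set.ext_iff.1 hinv x)
  let f : Shift k → ℝ := s.indicator 1
  have hf : Integrable f ν := (integrable_const (1 : ℝ)).indicator hs
  have hfi : ∀ i x, f ((shiftMap k)^[i] x) = f x := fun i x => by
    simp only [f, indicator_apply, hiter, Pi.one_apply]
  have hclose : ∀ ε > 0, ∃ c, ∫ x, |f x - c| ∂ν ≤ 3 * ε := fun ε hε => by
    obtain ⟨L, g, hL, hfg⟩ := exists_dependsOn_integral_sub_le hf hε
    obtain ⟨C, hC, hgC⟩ := exists_forall_abs_le g
    have hlim := (P.tendsto_defect L).const_mul (4 * C)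
    rw [mul_zero] at hlim
    obtain ⟨N, hN⟩ := (hlim.eventually_lt_const hε).exists
    obtain ⟨T, hT, hT₀⟩ := (((tendsto_const_div_atTop_nhds_zero_nat
      (4 * C * P.π N)).eventually_lt_const hε).and (eventually_gt_atTop 0)).exists
    have hT' : (0 : ℝ) < T := by exact_mod_cast hT₀
    refine ⟨P.mean N g, ?_⟩
    have hg : Integrable g ν := .of_bound g.continuous.aestronglyMeasurable C (.of_forall hgC)
    have hgi : ∀ i, Integrable (fun x => g ((shiftMap k)^[i] x)) ν := fun i =>
      (hmp.iterate i).integrable_comp_of_integrable hg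
    have hdi : ∀ i, Integrable (fun x => |f ((shiftMap k)^[i] x) - g ((shiftMap k)^[i] x)|) ν :=
      fun i => (hmp.iterate i).integrable_comp_of_integrable (hf.sub hg).abs
    have hd : ∀ i, ∫ x, |f ((shiftMap k)^[i] x) - g ((shiftMap k)^[i] x)| ∂ν =
        ∫ x, |f x - g x| ∂ν := fun i => by
      have hm := (hmp.iterate i).measurable
      have h := integral_map (μ := ν) hm.aemeasurable (f := fun x => |f x - g x|)
        (by rw [(hmp.iterate i).map_eq]; exact (hf.sub hg).abs.aestronglyMeasurable)
      rw [← h, (hmp.iterate i).map_eq]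
    have hB : Integrable (fun x =>
        |(∑ i ∈ Finset.range T, g ((shiftMap k)^[i] x)) / T - P.mean N g|) ν :=
      (((integrable_finsetSum _ fun i _ => hgi i).div_const _).sub (integrable_const _)).abs
    have hA : Integrable (fun x => (∑ i ∈ Finset.range T,
        |f ((shiftMap k)^[i] x) - g ((shiftMap k)^[i] x)|) / T) ν :=
      (integrable_finsetSum _ fun i _ => hdi i).div_const _
    have hpt : ∀ x, |f x - P.mean N g| ≤
        (∑ i ∈ Finset.range T, |f ((shiftMap k)^[i] x) - g ((shiftMap k)^[i] x)|) / T +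
        |(∑ i ∈ Finset.range T, g ((shiftMap k)^[i] x)) / T - P.mean N g| := fun x => by
      refine (abs_sub_le _ ((∑ i ∈ Finset.range T, g ((shiftMap k)^[i] x)) / T) _).trans
        (add_le_add_left ?_ _)
      have h₁ : f x - (∑ i ∈ Finset.range T, g ((shiftMap k)^[i] x)) / T =
          (∑ i ∈ Finset.range T, (f ((shiftMap k)^[i] x) - g ((shiftMap k)^[i] x))) / T := by
        simp only [hfi, Finset.sum_sub_distrib]
        simp
        field_simp
      rw [h₁, abs_div, abs_of_pos hT']
      gcongr
      exact Finset.abs_sum_le_sum_abs _ _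
    have h := integral_mono (hf.sub (integrable_const _)).abs (hA.add hB) hpt
    have h₂ := P.integral_birkhoff_sub_mean_le hν hgC hL N hT₀
    have h₃ := integral_add hA hB
    rw [integral_div, integral_finsetSum _ fun i _ => hdi i] at h₃
    simp only [hd, Finset.sum_const, Finset.card_range, nsmul_eq_mul,
      mul_div_cancel_left₀ _ hT'.ne'] at h₃
    simp only [Pi.add_apply, Pi.sub_apply] at h
    linarith
  have hprod : ∀ ε > 0, ν.real s * ν.real sᶜ ≤ 6 * ε := fun ε hε => by
    obtain ⟨c, hc⟩ := hclose ε hε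
    have hle : ∀ t : Set (Shift k), MeasurableSet t → (∀ x ∈ t, 1 / 2 ≤ |f x - c|) →
        ν.real t ≤ 6 * ε := fun t ht h => by
      have h₁ : ∫ x, t.indicator (fun _ => (1 / 2 : ℝ)) x ∂ν ≤ ∫ x, |f x - c| ∂ν :=
        integral_mono ((integrable_const _).indicator ht) (hf.sub (integrable_const _)).abs
          fun x => by
            by_cases hx : x ∈ t
            · simpa [hx] using h x hx
            · simp [hx]
      rw [integral_indicator_const _ ht, smul_eq_mul] at h₁
      linarith
    have hs₁ := measureReal_le_one (μ := ν) (s := s)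
    have hs₂ := measureReal_le_one (μ := ν) (s := sᶜ)
    have hs₃ := measureReal_nonneg (μ := ν) (s := s)
    have hs₄ := measureReal_nonneg (μ := ν) (s := sᶜ)
    rcases le_total (1 / 2) c with hc' | hc'
    · have := hle sᶜ hs.compl fun x hx => by
        simp only [f, indicator_of_notMem hx]
        rw [zero_sub, abs_neg]
        exact hc'.trans (le_abs_self c)
      nlinarith
    · have := hle s hs fun x hx => by
        simp only [f, indicator_of_mem hx, Pi.one_apply]
        exact le_trans (by linarith) (le_abs_self _)
      nlinarith
  have hzero : ν.real s * ν.real sᶜ ≤ 0 := le_of_forall_pos_le_add fun ε hε => by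
    have := hprod (ε / 6) (by positivity)
    linarith
  rw [eventuallyConst_set']
  rcases mul_eq_zero.1 (hzero.antisymm (by positivity)) with h | h
  · exact .inl (ae_eq_empty.2 ((measureReal_eq_zero_iff (by simp)).1 h))
  · exact .inr (ae_eq_univ.2 ((measureReal_eq_zero_iff (by simp)).1 h))

omit [IsProbabilityMeasure ν] in
lemma measureReal_le_defect {L : ℕ} {B : Set (Shift k)} (hB : DependsOn (· ∈ B) (Icc (-L : ℤ) L))
    (N : ℕ) (hN : ∀ ℓ, P.orb N ℓ ∉ B) : MeasurableSet B ∧ ν.real B ≤ P.defect L N := by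
  classical
  let f : Shift k → ℝ := B.indicator 1
  have hf : DependsOn f (Icc (-L : ℤ) L) := fun x y hxy => by
    have h : (x ∈ B) = (y ∈ B) := hB hxy
    simp only [f, indicator_apply, h, Pi.one_apply]
  have hfc := hf.continuous_of_finite (finite_Icc _ _)
  have hBm : MeasurableSet B := by
    convert hfc.measurable (measurableSet_singleton 1)
    ext x
    simp [f, indicator_apply]
  refine ⟨hBm, ?_⟩
  have hint : ∫ x, f x ∂ν = ν.real B := integral_indicator_one hBm
  rw [← hint]
  have h := (P.tendsto_mean hν ⟨f, hfc⟩).comp (tendsto_add_atTop_nat N)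
  refine le_of_tendsto' h fun j => ?_
  have hnn : ∀ x, 0 ≤ f x := fun x => by simp only [f, indicator_apply]; split_ifs <;> simp
  have hle : ∀ x, f x ≤ 1 := fun x => by simp only [f, indicator_apply]; split_ifs <;> simp
  have h₀ : P.orbitAvg N (fun ℓ => f (P.orb (N + 0) ℓ)) = 0 := by
    have : (fun ℓ => f (P.orb (N + 0) ℓ)) = fun _ => 0 := by
      ext ℓ
      exact indicator_of_notMem (hN ℓ) _
    rw [this, orbitAvg_const]
  have hmain := P.orbitAvg_add_le (N := N) (L := L) (C := 1) (a := fun j ℓ => f (P.orb (N + j) ℓ))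
    (fun j ℓ => by simp only [P.orb_periodic (N + j) ℓ]) (fun _ _ => hnn _) zero_le_one
    (fun _ _ => hle _) (fun j ℓ h₁ h₂ => (P.apply_orb_succ hf h₁ h₂).le) j
  rw [h₀] at hmain
  simp only [Function.comp, mean, ContinuousMap.coe_mk]
  rw [add_comm j N]
  linarith

lemma entropy_le {m : ℕ} {c c' : Shift k → Fin m} (hc : Measurable c) {L : ℕ}
    (hc' : DependsOn c' (Icc (-L : ℤ) L)) {α β : ℝ} (hα : 0 < α) (hβ : 0 < β)
    (hα₁ : α ≤ 1) (hβ₁ : β ≤ 1) (hαβ : α + m * β ≤ 1) (N n : ℕ) :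
    (∑ s : Fin (n + 1) → Fin m, Real.negMulLog
      (ν {x | ∀ i : Fin (n + 1), c ((shiftMap k)^[(i : ℕ)] x) = s i}).toReal) / ((n : ℝ) + 1) ≤
      Real.log (P.π N) / (n + 1) - Real.log α +
        -Real.log β * (ν.real {x | c x ≠ c' x} + P.defect (L + n) N) := by
  classical
  have hmp := P.measurePreserving_limit hν
  have hβ' : 0 ≤ -Real.log β := by linarith [Real.log_nonpos hβ.le hβ₁]
  have hc'm : Measurable c' := (hc'.continuous_of_finite (finite_Icc _ _)).measurable
  let D : Set (Shift k) := {x | c x ≠ c' x}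
  have hD : MeasurableSet D := (measurableSet_eq_fun hc hc'm).compl
  let B : Set (Shift k) := {x | ∀ ℓ < P.π N, ∃ i : Fin (n + 1),
    c' ((shiftMap k)^[(i : ℕ)] x) ≠ c' (P.orb N (ℓ + i))}
  have hBdep : DependsOn (· ∈ B) (Icc (-(L + n : ℕ) : ℤ) (L + n : ℕ)) := fun x y hxy => by
    have h : ∀ i : Fin (n + 1),
        c' ((shiftMap k)^[(i : ℕ)] x) = c' ((shiftMap k)^[(i : ℕ)] y) := fun i =>
      hc' fun j hj => by
        rw [shiftMap_iterate_apply, shiftMap_iterate_apply]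
        have := i.2
        exact hxy _ ⟨by have := hj.1; push_cast; omega, by have := hj.2; push_cast; omega⟩
    simp only [B, mem_ofPred_eq, h]
  have hBN : ∀ ℓ, P.orb N ℓ ∉ B := fun ℓ hℓ => by
    obtain ⟨i, hi⟩ := hℓ (ℓ % P.π N) (Nat.mod_lt _ (P.π_pos N))
    apply hi
    rw [← P.iterate_orb N (ℓ % P.π N), (P.orb_periodic N).map_mod_nat]
  obtain ⟨hBm, hBle⟩ := P.measureReal_le_defect hν hBdep N hBN
  let y : ℕ → Fin (n + 1) → Fin m := fun ℓ i => c' (P.orb N (ℓ + i))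
  let F : Shift k → Fin (n + 1) → Fin m := fun x i => c ((shiftMap k)^[(i : ℕ)] x)
  have hF : Measurable F := measurable_pi_lambda _ fun i => hc.comp (hmp.iterate i).measurable
  let G : Shift k → ℝ := fun x => Real.log (P.π N) + (n + 1 : ℕ) * -Real.log α +
    -Real.log β * (∑ i : Fin (n + 1), D.indicator (1 : Shift k → ℝ) ((shiftMap k)^[(i : ℕ)] x) +
      (n + 1) * B.indicator 1 x)
  have hDi : ∀ i : Fin (n + 1),
      Integrable (fun x => D.indicator (1 : Shift k → ℝ) ((shiftMap k)^[(i : ℕ)] x)) ν := fun i =>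
    (hmp.iterate i).integrable_comp_of_integrable ((integrable_const (1 : ℝ)).indicator hD)
  have hBi : Integrable (B.indicator (1 : Shift k → ℝ)) ν :=
    (integrable_const (1 : ℝ)).indicator hBm
  have hDint : ∀ i : Fin (n + 1),
      ∫ x, D.indicator (1 : Shift k → ℝ) ((shiftMap k)^[(i : ℕ)] x) ∂ν = ν.real D := fun i => by
    have h : (fun x => D.indicator (1 : Shift k → ℝ) ((shiftMap k)^[(i : ℕ)] x)) =
        ((shiftMap k)^[(i : ℕ)] ⁻¹' D).indicator 1 := rfl
    rw [h, integral_indicator_one ((hmp.iterate i).measurable hD),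
      (hmp.iterate i).measureReal_preimage hD.nullMeasurableSet]
  have hSi := integrable_finsetSum Finset.univ fun i _ => hDi i
  have hG₁ := (hSi.add (hBi.const_mul ((n : ℝ) + 1))).const_mul (-Real.log β)
  have hG : Integrable G ν := (integrable_const _).add hG₁
  have hGint : ∫ x, G x ∂ν = Real.log (P.π N) + (n + 1) * -Real.log α +
      -Real.log β * ((n + 1) * ν.real D + (n + 1) * ν.real B) := by
    have h₁ := integral_add (integrable_const (Real.log (P.π N) + (n + 1 : ℕ) * -Real.log α)) hG₁
    have h₂ := integral_add hSi (hBi.const_mul ((n : ℝ) + 1))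
    rw [integral_finsetSum _ fun i _ => hDi i, integral_const_mul, integral_indicator_one hBm] at h₂
    simp only [hDint] at h₂
    simp only [Pi.add_apply, integral_const_mul] at h₁
    simp only [G]
    rw [h₁, h₂]
    simp
  have hle : ∀ x, -Real.log (noisyWordLaw α β (P.π N) y (F x)) ≤ G x := fun x => by
    have hx : ∃ ℓ < P.π N, ∀ i : Fin (n + 1), (if F x i = y ℓ i then 0 else -Real.log β) ≤
        -Real.log β * (D.indicator (1 : Shift k → ℝ) ((shiftMap k)^[(i : ℕ)] x) +
          B.indicator 1 x) := by
      by_cases hxB : x ∈ B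
      · refine ⟨0, P.π_pos N, fun i => ?_⟩
        have : (0 : ℝ) ≤ D.indicator (1 : Shift k → ℝ) ((shiftMap k)^[(i : ℕ)] x) :=
          indicator_nonneg (fun _ _ => zero_le_one) _
        simp only [indicator_of_mem hxB, Pi.one_apply]
        split_ifs <;> nlinarith
      · have hxB' := hxB
        simp only [B, mem_ofPred_eq] at hxB'
        push Not at hxB'
        obtain ⟨ℓ, hℓ, h⟩ := hxB'
        refine ⟨ℓ, hℓ, fun i => ?_⟩
        by_cases hxD : (shiftMap k)^[(i : ℕ)] x ∈ D
        · simp only [indicator_of_mem hxD, indicator_of_notMem hxB, Pi.one_apply]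
          split_ifs <;> linarith
        · have : F x i = y ℓ i := (not_not.1 hxD).trans (h i)
          simp [this, indicator_of_notMem hxD, indicator_of_notMem hxB]
    obtain ⟨ℓ, hℓ, h⟩ := hx
    refine (neg_log_noisyWordLaw_le y hα hβ hα₁ hℓ (F x)).trans ?_
    refine add_le_add_right ((Finset.sum_le_sum fun i _ => h i).trans (le_of_eq ?_)) _
    rw [← Finset.mul_sum, Finset.sum_add_distrib]
    simp
  have hH := sum_negMulLog_le_integral hF (fun s => noisyWordLaw_pos y hα hβ (P.π_pos N) s)
    (sum_noisyWordLaw_le_one y hα hβ hαβ) hG hle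
  have hset : ∀ s : Fin (n + 1) → Fin m,
      F ⁻¹' {s} = {x | ∀ i : Fin (n + 1), c ((shiftMap k)^[(i : ℕ)] x) = s i} := fun s => by
    ext x
    simp [F, funext_iff]
  simp only [hset, hGint] at hH
  have hn : (0 : ℝ) < n + 1 := by positivity
  rw [div_le_iff₀ hn]
  refine hH.trans ?_
  have h₁ : Real.log (P.π N) / (n + 1) * (n + 1) = Real.log (P.π N) := div_mul_cancel₀ _ hn.ne'
  have h₂ : -Real.log β * ((n + 1) * ν.real D + (n + 1) * ν.real B) ≤
      -Real.log β * ((n + 1) * ν.real D + (n + 1) * P.defect (L + n) N) := by gcongr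
  simp only [D] at h₂ ⊢
  linarith

omit hν in
lemma tendsto_entropy_bound (L : ℕ) (a b d : ℝ) :
    Tendsto (fun N => Real.log (P.π N) / (((P.π N).sqrt : ℝ) + 1) - a +
      b * (d + P.defect (L + (P.π N).sqrt) N)) atTop (nhds (-a + b * d)) := by
  have hsqrt : Tendsto (fun N => (P.π N).sqrt) atTop atTop :=
    tendsto_atTop.2 fun b => (P.tendsto_π.eventually_ge_atTop (b * b)).mono fun N hN =>
      Nat.le_sqrt.2 hN
  have hlog : Tendsto (fun N => Real.log (P.π N) / (((P.π N).sqrt : ℝ) + 1)) atTop (nhds 0) := by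
    have h₁ : Tendsto (fun n : ℕ => 2 * (Real.log ((n + 1 : ℕ) : ℝ) / ((n + 1 : ℕ) : ℝ)))
        atTop (nhds (2 * 0)) :=
      ((Real.isLittleO_log_id_atTop.tendsto_div_nhds_zero.comp
        tendsto_natCast_atTop_atTop).comp (tendsto_add_atTop_nat 1)).const_mul 2
    rw [mul_zero] at h₁
    refine squeeze_zero (fun N => div_nonneg (Real.log_natCast_nonneg _) (by positivity))
      (fun N => ?_) (h₁.comp hsqrt)
    have h₂ : (P.π N : ℝ) ≤ (((P.π N).sqrt : ℝ) + 1) ^ 2 := by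
      exact_mod_cast (Nat.lt_succ_sqrt' (P.π N)).le
    have h₃ := Real.log_le_log (P.π_cast_pos N) h₂
    rw [Real.log_pow] at h₃
    simp only [Function.comp]
    push_cast at h₃ ⊢
    rw [← mul_div_assoc]
    gcongr
  have hdefect : Tendsto (fun N => P.defect (L + (P.π N).sqrt) N) atTop (nhds 0) := by
    have h₁ : Tendsto (fun N => P.defect L N + 2 * (((P.π N).sqrt : ℕ) : ℝ)⁻¹) atTop
        (nhds (0 + 2 * 0)) :=
      (P.tendsto_defect L).add (((tendsto_inv_atTop_zero.comp
        (tendsto_natCast_atTop_atTop (R := ℝ))).comp hsqrt).const_mul 2)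
    rw [mul_zero, add_zero] at h₁
    refine squeeze_zero (fun N => P.defect_nonneg _ _) (fun N => ?_) h₁
    have hpos : (0 : ℝ) < (P.π N).sqrt := by exact_mod_cast Nat.sqrt_pos.2 (P.π_pos N)
    have h₂ : ((P.π N).sqrt * (P.π N).sqrt : ℝ) ≤ P.π N := by exact_mod_cast Nat.sqrt_le (P.π N)
    have h₃ : ((P.π N).sqrt / P.π N : ℝ) ≤ ((P.π N).sqrt : ℝ)⁻¹ := by
      rw [div_le_iff₀ (P.π_cast_pos N), inv_mul_eq_div, le_div_iff₀ hpos]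
      exact h₂
    have h₄ : P.defect (L + (P.π N).sqrt) N =
        P.defect L N + 2 * ((P.π N).sqrt / P.π N : ℝ) := by
      simp only [defect]
      push_cast
      ring
    rw [h₄]
    linarith
  simpa using (hlog.sub_const a).add ((hdefect.const_add d).const_mul b)

lemma iInf_entropy_eq_zero {m : ℕ} {c : Shift k → Fin m} (hc : Measurable c) :
    ⨅ n : ℕ, ENNReal.ofReal ((∑ s : Fin (n + 1) → Fin m, Real.negMulLog
      ((ν {x | ∀ i : Fin (n + 1), c ((shiftMap k)^[(i : ℕ)] x) = s i}).toReal)) / ((n : ℝ) + 1)) =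
      0 := by
  have hm : 0 < m := (c (P.ξp 0)).pos
  have hm' : (0 : ℝ) < m := by exact_mod_cast hm
  refine le_antisymm (ENNReal.le_of_forall_pos_le_add fun δ hδ _ => ?_) zero_le
  rw [zero_add]
  replace hδ : (0 : ℝ) < δ := by exact_mod_cast hδ
  set α := Real.exp (-(δ / 3 : ℝ)) with hα
  have hα₁ : α < 1 := Real.exp_lt_one_iff.2 (by linarith)
  have hα₀ : 0 < α := Real.exp_pos _
  set β := (1 - α) / m with hβ
  have hβ₀ : 0 < β := div_pos (by linarith) hm'
  have hαβ : α + m * β ≤ 1 := by rw [hβ, mul_div_cancel₀ _ hm'.ne']; linarith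
  have hβ₁ : β ≤ 1 := by
    have : (1 : ℝ) ≤ m := by exact_mod_cast hm
    nlinarith
  set b := -Real.log β
  have hb : 0 ≤ b := by linarith [Real.log_nonpos hβ₀.le hβ₁]
  have hcr : Measurable fun x => ((c x : ℕ) : ℝ) :=
    (measurable_of_countable fun a : Fin m => ((a : ℕ) : ℝ)).comp hc
  have hci : Integrable (fun x => ((c x : ℕ) : ℝ)) ν :=
    .of_bound hcr.aestronglyMeasurable m (.of_forall fun x => by simp)
  obtain ⟨L, g, hL, hg⟩ := exists_dependsOn_integral_sub_le hci
    (by positivity : 0 < δ / (6 * (b + 1)))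
  let c' : Shift k → Fin m := fun x => ⟨(round (g x)).toNat % m, Nat.mod_lt _ hm⟩
  have hc' : DependsOn c' (Icc (-L : ℤ) L) := fun x y hxy => by simp only [c', hL hxy]
  have hfar : {x | c x ≠ c' x} ⊆ {x | 1 / 2 ≤ |((c x : ℕ) : ℝ) - g x|} := fun x hx => by
    by_contra h
    simp only [mem_ofPred_eq, not_le] at h
    apply hx
    have hround : round (g x) = ((c x : ℕ) : ℤ) := by
      rw [abs_lt] at h
      rw [round_eq, Int.floor_eq_iff]
      push_cast
      constructor <;> linarith
    ext
    simp [c', hround, Nat.mod_eq_of_lt (c x).2]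
  have hgi : Integrable g ν := by
    obtain ⟨C, -, hC⟩ := exists_forall_abs_le g
    exact .of_bound g.continuous.aestronglyMeasurable C (.of_forall hC)
  have hmarkov := mul_meas_ge_le_integral_of_nonneg (.of_forall fun x => abs_nonneg _)
    (hci.sub hgi).abs (1 / 2)
  have hd : ν.real {x | c x ≠ c' x} ≤ 2 * (δ / (6 * (b + 1))) := by
    have h₁ := measureReal_mono (μ := ν) hfar
    simp only [Pi.sub_apply] at hmarkov
    linarith
  have hlim := P.tendsto_entropy_bound L (Real.log α) b (ν.real {x | c x ≠ c' x})
  have hlt : -Real.log α + b * ν.real {x | c x ≠ c' x} < δ := by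
    have h₁ : -Real.log α = δ / 3 := by rw [hα, Real.log_exp, neg_neg]
    have h₂ : b * ν.real {x | c x ≠ c' x} ≤ (b + 1) * (2 * (δ / (6 * (b + 1)))) := by
      gcongr
      linarith
    have h₃ : (b + 1) * (2 * (δ / (6 * (b + 1)))) = (δ / 3 : ℝ) := by
      have : b + 1 ≠ 0 := by positivity
      field_simp
      norm_num
    linarith
  obtain ⟨N, hN⟩ := (hlim.eventually_lt_const hlt).exists
  refine (iInf_le _ (P.π N).sqrt).trans ?_
  rw [ENNReal.ofReal_le_iff_le_toReal ENNReal.coe_ne_top, ENNReal.coe_toReal]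
  exact (P.entropy_le hν hc hc' hα₀ hβ₀ hα₁.le hβ₁ hαβ N _).trans hN.le

end RepetitivePattern

/-- If `X_n = O((ξ_n, q_n))` is a sequence of `T`-periodic orbits with
repetitive pattern, then the projected measures `ν_n = (1/π_n) ∑_{ℓ<π_n} δ_{σ^ℓ ξ_n}`
converge weak-star to a `σ`-invariant ergodic probability measure `ν` with `h_ν(σ) = 0`. -/
theorem projected_measures_converge_ergodic_zero_entropy
    {k : ℕ} (S : SkewSetup k) (P : RepetitivePattern S) :
    ∃ ν : Measure (Shift k), IsProbabilityMeasure ν ∧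
      WeakStarTendsto (fun n => P.νX n) ν ∧
      MeasurePreserving (shiftMap k) ν ν ∧
      Ergodic (shiftMap k) ν ∧
      ksEntropy (shiftMap k) ν = 0 := by
  obtain ⟨ν, _, hν⟩ := P.exists_limit
  refine ⟨ν, inferInstance, hν, P.measurePreserving_limit hν, P.ergodic_limit hν, ?_⟩
  simp only [ksEntropy, ENNReal.iSup_eq_zero]
  rintro m ⟨c, hc⟩
  exact P.iInf_entropy_eq_zero hν hc

end
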